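/- Let X₀ ∈ ℝ^{n×k}, let q ≥ 1 be an integer, let ρ: ℝ → ℝ, and set X = Q ρ(Λ)^q Qᵀ X₀ (i.e., X = ρ(A)^q X₀). Assume the ordering condition min_{1≤j≤k}|ρ(λ_j)| = |ρ(λ_k)| ≥ |ρ(λ_{k+1})| ≥ ⋯ ≥ |ρ(λ_{m+1})| = max_{m<j≤n}|ρ(λ_j)| with |ρ(λ_{k+1})| > 0, and assume min_{i≤k} ‖q_iᵀX₀‖₂ > 0, min_{j>k} ‖q_jᵀX₀‖₂ > 0, and min_{i≤k} ‖e_iᵀV‖₂ > 0. Then under the G₁-Assumption, δ_k(Y) ≤ c′_m · |ρ(λ_{m+1})/ρ(λ_{k+1})|^q · δ_k(X), where c′_m = ((max_{j>m} ‖q_jᵀX₀‖₂)/(min_{j>k} ‖q_jᵀX₀‖₂)) · Γ_{k,m}(V) · ‖G₁† E_k‖₂ and ‖·‖₂ on a matrix denotes the spectral norm. -/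

import Mathlib

open Matrix

namespace ARR

/-- Euclidean norm of the `i`-th row of a matrix. -/
noncomputable def rowNorm {R C : Type*} [Fintype C] (M : Matrix R C ℝ) (i : R) : ℝ :=
  Real.sqrt (∑ j, M i j ^ 2)

/-- Supremum of `f` over indices satisfying `P`. -/
noncomputable def supOver {n : ℕ} (P : Fin n → Prop) (f : Fin n → ℝ) : ℝ :=
  sSup (f '' {i | P i})

/-- Infimum of `f` over indices satisfying `P`. -/
noncomputable def infOver {n : ℕ} (P : Fin n → Prop) (f : Fin n → ℝ) : ℝ :=
  sInf (f '' {i | P i})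

/-- The accuracy measure `δₖ(Z) = max_{i>k} ‖qᵢᵀZ‖ / min_{i≤k} ‖qᵢᵀZ‖`
(indices are 1-based in the paper; here `i > k` means `k ≤ i` for 0-based `i`). -/
noncomputable def deltaK {n k : ℕ} (Q : Matrix (Fin n) (Fin n) ℝ)
    (Z : Matrix (Fin n) (Fin k) ℝ) : ℝ :=
  supOver (fun i => k ≤ (i : ℕ)) (rowNorm (Qᵀ * Z)) /
    infOver (fun i => (i : ℕ) < k) (rowNorm (Qᵀ * Z))

/-- `Γ_{k,m}(M) = max_{i>m} ‖eᵢᵀM‖ / min_{i≤k} ‖eᵢᵀM‖`. -/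
noncomputable def gammaKM {n : ℕ} {C : Type*} [Fintype C] (k m : ℕ)
    (M : Matrix (Fin n) C ℝ) : ℝ :=
  supOver (fun i => m ≤ (i : ℕ)) (rowNorm M) / infOver (fun i => (i : ℕ) < k) (rowNorm M)

/-- Spectral (operator 2-) norm of a matrix. -/
noncomputable def specNorm {a b : Type*} [Fintype a] [Fintype b] [DecidableEq b]
    (M : Matrix a b ℝ) : ℝ :=
  ‖LinearMap.toContinuousLinearMap (Matrix.toEuclideanLin M)‖

/-- The Vandermonde matrix `V` with `V i j = λᵢ^j`, `0 ≤ j ≤ p`. -/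
def vand {n : ℕ} (lam : Fin n → ℝ) (p : ℕ) : Matrix (Fin n) (Fin (p + 1)) ℝ :=
  fun i j => lam i ^ (j : ℕ)

/-- The diagonal of `D`: `Dᵢᵢ = ‖qᵢᵀX‖₂ ⬝ ‖eᵢᵀV‖₂` (the norm of the `i`-th row of `Ĝ`). -/
noncomputable def dvec {n k : ℕ} (lam : Fin n → ℝ) (p : ℕ) (Q : Matrix (Fin n) (Fin n) ℝ)
    (X : Matrix (Fin n) (Fin k) ℝ) : Fin n → ℝ :=
  fun i => rowNorm (Qᵀ * X) i * rowNorm (vand lam p) i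

/-- `G = D† Ĝ`, where `Ĝ = [QᵀX, ΛQᵀX, …, ΛᵖQᵀX]`; the column block index is `j.1`. -/
noncomputable def gmat {n k : ℕ} (lam : Fin n → ℝ) (p : ℕ) (Q : Matrix (Fin n) (Fin n) ℝ)
    (X : Matrix (Fin n) (Fin k) ℝ) : Matrix (Fin n) (Fin (p + 1) × Fin k) ℝ :=
  fun i j => (dvec lam p Q X i)⁻¹ * (lam i ^ (j.1 : ℕ) * (Qᵀ * X) i j.2)

/-- The augmented matrix `X_p = [X, AX, …, AᵖX]`; the column block index is `j.1`. -/
noncomputable def aug {n k : ℕ} (A : Matrix (Fin n) (Fin n) ℝ)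
    (X : Matrix (Fin n) (Fin k) ℝ) (p : ℕ) : Matrix (Fin n) (Fin (p + 1) × Fin k) ℝ :=
  fun i j => (A ^ (j.1 : ℕ) * X) i j.2

/-- First `m` rows of a matrix. -/
def topRows {n : ℕ} {C : Type*} (m : ℕ) (hmn : m ≤ n) (M : Matrix (Fin n) C ℝ) :
    Matrix (Fin m) C ℝ :=
  fun i j => M (Fin.castLE hmn i) j

/-- Last `n - m` rows of a matrix. -/
def lowRows {n : ℕ} {C : Type*} (m : ℕ) (hmn : m ≤ n) (M : Matrix (Fin n) C ℝ) :
    Matrix (Fin (n - m)) C ℝ :=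
  fun i j => M ⟨m + (i : ℕ), by have := i.isLt; omega⟩ j

/-- First `m` columns of a square matrix (`Q_m`). -/
def colsTop {n : ℕ} (m : ℕ) (hmn : m ≤ n) (M : Matrix (Fin n) (Fin n) ℝ) :
    Matrix (Fin n) (Fin m) ℝ :=
  fun i j => M i (Fin.castLE hmn j)

/-- Last `n - m` columns of a square matrix (`Q_{m+}`). -/
def colsLow {n : ℕ} (m : ℕ) (hmn : m ≤ n) (M : Matrix (Fin n) (Fin n) ℝ) :
    Matrix (Fin n) (Fin (n - m)) ℝ :=
  fun i j => M i ⟨m + (j : ℕ), by have := j.isLt; omega⟩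

/-- `E_k`: the first `k` columns of the `m × m` identity matrix. -/
def ekMat (m k : ℕ) : Matrix (Fin m) (Fin k) ℝ :=
  fun i j => if (i : ℕ) = (j : ℕ) then 1 else 0

/-- `D₁⁻¹`: the inverse of the leading `m × m` block of `D`. -/
noncomputable def d1inv {n : ℕ} (m : ℕ) (hmn : m ≤ n) (d : Fin n → ℝ) :
    Matrix (Fin m) (Fin m) ℝ :=
  Matrix.diagonal fun i => (d (Fin.castLE hmn i))⁻¹

/-- `D₂`: the trailing `(n-m) × (n-m)` block of `D`. -/
noncomputable def d2mat {n : ℕ} (m : ℕ) (hmn : m ≤ n) (d : Fin n → ℝ) :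
    Matrix (Fin (n - m)) (Fin (n - m)) ℝ :=
  Matrix.diagonal fun i => d ⟨m + (i : ℕ), by have := i.isLt; omega⟩

/-- `Y = X_p G₁† D₁⁻¹ E_k`, where `A = Q Λ Qᵀ` and `X_p = [X, AX, …, AᵖX]`. -/
noncomputable def ymat {n k : ℕ} (m : ℕ) (hmn : m ≤ n) (lam : Fin n → ℝ) (p : ℕ)
    (Q : Matrix (Fin n) (Fin n) ℝ) (X : Matrix (Fin n) (Fin k) ℝ)
    (Gpinv : Matrix (Fin (p + 1) × Fin k) (Fin m) ℝ) : Matrix (Fin n) (Fin k) ℝ :=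
  aug (Q * Matrix.diagonal lam * Qᵀ) X p * Gpinv * d1inv m hmn (dvec lam p Q X) * ekMat m k

end ARR

namespace ARR

section Extrema

variable {n : ℕ} {P : Fin n → Prop} {f : Fin n → ℝ}

lemma le_supOver {i : Fin n} (hi : P i) : f i ≤ supOver P f :=
  le_csSup (Set.toFinite _).bddAbove ⟨i, hi, rfl⟩

lemma infOver_le {i : Fin n} (hi : P i) : infOver P f ≤ f i :=
  csInf_le (Set.toFinite _).bddBelow ⟨i, hi, rfl⟩

lemma supOver_le {B : ℝ} (hP : ∃ i, P i) (h : ∀ i, P i → f i ≤ B) : supOver P f ≤ B := by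
  obtain ⟨i, hi⟩ := hP
  refine csSup_le ⟨f i, i, hi, rfl⟩ ?_
  rintro _ ⟨j, hj, rfl⟩
  exact h j hj

lemma le_infOver {B : ℝ} (hP : ∃ i, P i) (h : ∀ i, P i → B ≤ f i) : B ≤ infOver P f := by
  obtain ⟨i, hi⟩ := hP
  refine le_csInf ⟨f i, i, hi, rfl⟩ ?_
  rintro _ ⟨j, hj, rfl⟩
  exact h j hj

lemma infOver_pos (hP : ∃ i, P i) (h : ∀ i, P i → 0 < f i) : 0 < infOver P f := by
  obtain ⟨i, hi⟩ := hP
  obtain ⟨j, hj, hij⟩ := Set.Nonempty.csInf_mem (s := f '' {i | P i}) ⟨f i, i, hi, rfl⟩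
    (Set.toFinite _)
  exact (h j hj).trans_eq hij

end Extrema

section RowNorm

variable {R R' C : Type*} [Fintype C]

lemma rowNorm_nonneg (M : Matrix R C ℝ) (i : R) : 0 ≤ rowNorm M i := Real.sqrt_nonneg _

lemma rowNorm_eq_abs_mul {M' : Matrix R' C ℝ} {M : Matrix R C ℝ} {i' : R'} {i : R} {c : ℝ}
    (h : ∀ j, M' i' j = c * M i j) : rowNorm M' i' = |c| * rowNorm M i := by
  simp only [rowNorm, h, mul_pow, ← Finset.mul_sum]
  rw [Real.sqrt_mul (sq_nonneg c), Real.sqrt_sq_eq_abs]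

lemma rowNorm_le_mul {M' : Matrix R' C ℝ} {M : Matrix R C ℝ} {i' : R'} {i : R} {c : ℝ}
    (hc : 0 ≤ c) (h : ∀ j, |M' i' j| ≤ c * |M i j|) : rowNorm M' i' ≤ c * rowNorm M i := by
  rw [← abs_of_nonneg hc, ← rowNorm_eq_abs_mul (M' := c • M) (i' := i) (fun j => rfl)]
  refine Real.sqrt_le_sqrt (Finset.sum_le_sum fun j _ => ?_)
  rw [sq_le_sq]
  simpa [abs_mul, abs_of_nonneg hc] using h j

lemma specNorm_nonneg {b : Type*} [Fintype b] [DecidableEq b] (M : Matrix C b ℝ) :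
    0 ≤ specNorm M :=
  norm_nonneg _

open scoped Matrix.Norms.L2Operator in
lemma rowNorm_mul_le {b : Type*} [Fintype b] [DecidableEq b] (A : Matrix R C ℝ)
    (M : Matrix C b ℝ) (i : R) : rowNorm (A * M) i ≤ rowNorm A i * specNorm M := by
  classical
  have h := l2_opNorm_mulVec Mᴴ (WithLp.toLp 2 (A i))
  rw [l2_opNorm_conjTranspose, EuclideanSpace.norm_eq, EuclideanSpace.norm_eq, mul_comm] at h
  simpa [rowNorm, specNorm, l2_opNorm_def, mulVec_transpose, vecMul, dotProduct,
    Matrix.mul_apply] using h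

end RowNorm

variable {n k : ℕ} (lam : Fin n → ℝ) (p : ℕ) (Q : Matrix (Fin n) (Fin n) ℝ)
  (X : Matrix (Fin n) (Fin k) ℝ)

lemma rowNorm_vand_pos (i : Fin n) : 0 < rowNorm (vand lam p) i := by
  refine Real.sqrt_pos.2 (Finset.sum_pos' (fun j _ => sq_nonneg _) ⟨0, Finset.mem_univ _, ?_⟩)
  simp [vand]

lemma dvec_nonneg (i : Fin n) : 0 ≤ dvec lam p Q X i :=
  mul_nonneg (rowNorm_nonneg _ _) (rowNorm_nonneg _ _)

lemma rowNorm_kron (i : Fin n) :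
    rowNorm (fun (i : Fin n) (j : Fin (p + 1) × Fin k) => lam i ^ (j.1 : ℕ) * (Qᵀ * X) i j.2) i
      = dvec lam p Q X i := by
  rw [dvec, mul_comm]
  simp only [rowNorm, vand]
  rw [← Real.sqrt_mul (Finset.sum_nonneg fun j _ => sq_nonneg _), Finset.sum_mul_sum,
    Fintype.sum_prod_type]
  simp only [mul_pow]

lemma rowNorm_gmat_le_one (i : Fin n) : rowNorm (gmat lam p Q X) i ≤ 1 := by
  rw [rowNorm_eq_abs_mul (M' := gmat lam p Q X) (i := i) (c := (dvec lam p Q X i)⁻¹)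
    (M := fun i j => lam i ^ (j.1 : ℕ) * (Qᵀ * X) i j.2) (fun j => rfl), rowNorm_kron, abs_inv,
    abs_of_nonneg (dvec_nonneg ..)]
  exact inv_mul_le_one

variable {lam p Q X}

lemma transpose_mul_aug (hQ' : Qᵀ * Q = 1) (i : Fin n) (j : Fin (p + 1) × Fin k) :
    (Qᵀ * aug (Q * diagonal lam * Qᵀ) X p) i j = dvec lam p Q X i * gmat lam p Q X i j := by
  have hsemi : SemiconjBy Qᵀ (Q * diagonal lam * Qᵀ) (diagonal lam) := by
    simp only [SemiconjBy, ← Matrix.mul_assoc, hQ', Matrix.one_mul]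
  have hpow := (hsemi.pow_right (j.1 : ℕ)).eq
  have hrow : (Qᵀ * aug (Q * diagonal lam * Qᵀ) X p) i j = lam i ^ (j.1 : ℕ) * (Qᵀ * X) i j.2 := by
    change (Qᵀ * ((Q * diagonal lam * Qᵀ) ^ (j.1 : ℕ) * X)) i j.2 = _
    rw [← Matrix.mul_assoc, hpow, Matrix.mul_assoc, diagonal_pow, diagonal_mul, Pi.pow_apply]
  rw [hrow, gmat]
  by_cases hd : dvec lam p Q X i = 0
  · have hW : rowNorm (Qᵀ * X) i = 0 :=
      (mul_eq_zero.1 hd).resolve_right (rowNorm_vand_pos lam p i).ne'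
    rw [rowNorm, Real.sqrt_eq_zero (Finset.sum_nonneg fun j _ => sq_nonneg _),
      Finset.sum_eq_zero_iff_of_nonneg fun j _ => sq_nonneg _] at hW
    have := pow_eq_zero_iff two_ne_zero |>.1 (hW j.2 (Finset.mem_univ _))
    simp [this]
  · rw [mul_inv_cancel_left₀ hd]

lemma mul_ekMat_apply {R : Type*} {m : ℕ} (hkm : k ≤ m) (B : Matrix R (Fin m) ℝ) (i : R)
    (j : Fin k) : (B * ekMat m k) i j = B i (Fin.castLE hkm j) := by
  rw [Matrix.mul_apply, Finset.sum_eq_single (Fin.castLE hkm j)]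
  · simp [ekMat]
  · intro b _ hb
    have : (b : ℕ) ≠ j := fun h => hb (Fin.ext h)
    simp [ekMat, this]
  · simp

variable {m : ℕ} {Gpinv : Matrix (Fin (p + 1) × Fin k) (Fin m) ℝ}

lemma transpose_mul_ymat (hQ' : Qᵀ * Q = 1) (hkm : k ≤ m) (hmn : m ≤ n) (i : Fin n)
    (j : Fin k) :
    (Qᵀ * ymat m hmn lam p Q X Gpinv) i j =
      dvec lam p Q X i * (gmat lam p Q X * Gpinv) i (Fin.castLE hkm j) *
        (dvec lam p Q X (Fin.castLE (hkm.trans hmn) j))⁻¹ := by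
  rw [ymat, ← Matrix.mul_assoc, mul_ekMat_apply hkm, ← Matrix.mul_assoc, d1inv, mul_diagonal]
  congr 1
  rw [← Matrix.mul_assoc]
  rw [Matrix.mul_apply, Matrix.mul_apply, Finset.mul_sum]
  exact Finset.sum_congr rfl fun l _ => by rw [transpose_mul_aug hQ', mul_assoc]

lemma gmat_mul_apply_of_lt (hmn : m ≤ n) (hG1 : topRows m hmn (gmat lam p Q X) * Gpinv = 1)
    {i : Fin n} (hi : (i : ℕ) < m) (j : Fin m) :
    (gmat lam p Q X * Gpinv) i j = if (i : ℕ) = j then 1 else 0 := by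
  have h : (gmat lam p Q X * Gpinv) i j = (1 : Matrix (Fin m) (Fin m) ℝ) ⟨i, hi⟩ j := by
    rw [← hG1]
    rfl
  rw [h, Matrix.one_apply]
  simp [Fin.ext_iff]

lemma dvec_pos_of_lt (hmn : m ≤ n) (hG1 : topRows m hmn (gmat lam p Q X) * Gpinv = 1)
    {i : Fin n} (hi : (i : ℕ) < m) : 0 < dvec lam p Q X i := by
  refine (dvec_nonneg ..).lt_of_ne' fun h0 => ?_
  have h := gmat_mul_apply_of_lt hmn hG1 hi ⟨i, hi⟩
  simp [Matrix.mul_apply, gmat, h0] at h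

lemma rowNorm_ymat_of_lt (hmn : m ≤ n) (hG1 : topRows m hmn (gmat lam p Q X) * Gpinv = 1)
    (hQ' : Qᵀ * Q = 1) (hkm : k ≤ m) {i : Fin n} (hi : (i : ℕ) < k) :
    rowNorm (Qᵀ * ymat m hmn lam p Q X Gpinv) i = 1 := by
  rw [rowNorm, Finset.sum_eq_single ⟨i, hi⟩]
  · rw [transpose_mul_ymat hQ' hkm, gmat_mul_apply_of_lt hmn hG1 (hi.trans_le hkm)]
    have := (dvec_pos_of_lt hmn hG1 (hi.trans_le hkm)).ne'
    simp [this]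
  · intro j _ hj
    have : (i : ℕ) ≠ j := fun h => hj (Fin.ext h.symm)
    rw [transpose_mul_ymat hQ' hkm, gmat_mul_apply_of_lt hmn hG1 (hi.trans_le hkm)]
    simp [this]
  · simp

lemma rowNorm_ymat_of_le_of_lt (hmn : m ≤ n) (hG1 : topRows m hmn (gmat lam p Q X) * Gpinv = 1)
    (hQ' : Qᵀ * Q = 1) (hkm : k ≤ m) {i : Fin n}
    (hik : k ≤ (i : ℕ)) (him : (i : ℕ) < m) :
    rowNorm (Qᵀ * ymat m hmn lam p Q X Gpinv) i = 0 := by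
  rw [rowNorm, Finset.sum_eq_zero, Real.sqrt_zero]
  intro j _
  have : (i : ℕ) ≠ j := by have := j.isLt; omega
  rw [transpose_mul_ymat hQ' hkm, gmat_mul_apply_of_lt hmn hG1 him]
  simp [this]

lemma rowNorm_ymat_le (hQ' : Qᵀ * Q = 1) (hkm : k ≤ m) (hmn : m ≤ n) {c : ℝ} (hc : 0 < c)
    (hd : ∀ j : Fin n, (j : ℕ) < k → c ≤ dvec lam p Q X j) (i : Fin n) :
    rowNorm (Qᵀ * ymat m hmn lam p Q X Gpinv) i ≤
      dvec lam p Q X i / c * specNorm (Gpinv * ekMat m k) := by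
  have h0 := dvec_nonneg lam p Q X i
  calc rowNorm (Qᵀ * ymat m hmn lam p Q X Gpinv) i
      ≤ dvec lam p Q X i / c * rowNorm (gmat lam p Q X * (Gpinv * ekMat m k)) i := by
        refine rowNorm_le_mul (by positivity) fun j => ?_
        have hj := hd (Fin.castLE (hkm.trans hmn) j) j.isLt
        rw [transpose_mul_ymat hQ' hkm, ← Matrix.mul_assoc, mul_ekMat_apply hkm, abs_mul, abs_mul,
          abs_of_nonneg h0, abs_of_pos (inv_pos.2 (hc.trans_le hj)), div_eq_mul_inv,
          mul_right_comm]
        gcongr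
    _ ≤ dvec lam p Q X i / c * (1 * specNorm (Gpinv * ekMat m k)) := by
        gcongr
        refine (rowNorm_mul_le _ _ i).trans ?_
        gcongr
        · exact specNorm_nonneg _
        · exact rowNorm_gmat_le_one ..
    _ = _ := by rw [one_mul]

lemma rowNorm_transpose_mul_filtered (hQ' : Qᵀ * Q = 1) (r : Fin n → ℝ) (q : ℕ)
    (X₀ : Matrix (Fin n) (Fin k) ℝ) (i : Fin n) :
    rowNorm (Qᵀ * (Q * diagonal r ^ q * Qᵀ * X₀)) i = |r i| ^ q * rowNorm (Qᵀ * X₀) i := by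
  rw [← abs_pow]
  refine rowNorm_eq_abs_mul fun j => ?_
  simp only [← Matrix.mul_assoc, hQ', Matrix.one_mul]
  rw [Matrix.mul_assoc, diagonal_pow, diagonal_mul, Pi.pow_apply]

end ARR

open ARR in
/-- Theorem 3.2, second part. With `X = ρ(A)^q X₀`, under the ordering
condition on `|ρ(λⱼ)|` and the `G₁`-Assumption,
`δₖ(Y) ≤ c'_m |ρ(λ_{m+1})/ρ(λ_{k+1})|^q δₖ(X)` where
`c'_m = (max_{j>m}‖qⱼᵀX₀‖ / min_{j>k}‖qⱼᵀX₀‖) Γ_{k,m}(V) ‖G₁†E_k‖₂`.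
(0-based indices: `λ_{k+1} = lam ⟨k⟩`, `λ_{m+1} = lam ⟨m⟩`.) -/
theorem arr_thm2_part2 {n k p m q : ℕ} (hq : 1 ≤ q) (hk : 0 < k) (hn : (p + 1) * k < n)
    (hkm : k ≤ m) (hmk : m ≤ k + p * k) (hm : m < n)
    (lam : Fin n → ℝ) (hlam : Antitone lam)
    (Q : Matrix (Fin n) (Fin n) ℝ) (hQ : Q * Qᵀ = 1) (hQ' : Qᵀ * Q = 1)
    (ρ : ℝ → ℝ) (X₀ X : Matrix (Fin n) (Fin k) ℝ)
    (hX : X = Q * (Matrix.diagonal fun i => ρ (lam i)) ^ q * Qᵀ * X₀)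
    (hordmin : ∀ j : Fin n, (j : ℕ) < k → |ρ (lam ⟨k - 1, by omega⟩)| ≤ |ρ (lam j)|)
    (horddec : ∀ i j : Fin n, k - 1 ≤ (i : ℕ) → (i : ℕ) ≤ (j : ℕ) → (j : ℕ) ≤ m →
      |ρ (lam j)| ≤ |ρ (lam i)|)
    (hordmax : ∀ j : Fin n, m ≤ (j : ℕ) → |ρ (lam j)| ≤ |ρ (lam ⟨m, hm⟩)|)
    (hρk1 : ρ (lam ⟨k, by omega⟩) ≠ 0)
    (hX₀ : 0 < infOver (fun i => (i : ℕ) < k) (rowNorm (Qᵀ * X₀)))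
    (hX₀' : 0 < infOver (fun j => k ≤ (j : ℕ)) (rowNorm (Qᵀ * X₀)))
    (hV : 0 < infOver (fun i => (i : ℕ) < k) (rowNorm (vand lam p)))
    (Gpinv : Matrix (Fin (p + 1) × Fin k) (Fin m) ℝ)
    (hG1 : topRows m hm.le (gmat lam p Q X) * Gpinv = 1) :
    deltaK Q (ymat m hm.le lam p Q X Gpinv) ≤
      ((supOver (fun j => m ≤ (j : ℕ)) (rowNorm (Qᵀ * X₀)) /
            infOver (fun j => k ≤ (j : ℕ)) (rowNorm (Qᵀ * X₀))) *
          gammaKM k m (vand lam p) * specNorm (Gpinv * ekMat m k)) *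
        |ρ (lam ⟨m, hm⟩) / ρ (lam ⟨k, by omega⟩)| ^ q * deltaK Q X := by
  have hV0 := fun i => (rowNorm_nonneg (vand lam p) i)
  have hW (i : Fin n) :
      rowNorm (Qᵀ * X) i = |ρ (lam i)| ^ q * rowNorm (Qᵀ * X₀) i := by
    rw [hX]
    exact rowNorm_transpose_mul_filtered hQ' _ q X₀ i
  have hex : ∃ i : Fin n, (i : ℕ) < k := ⟨⟨0, by omega⟩, hk⟩
  have hWinf : 0 < infOver (fun i => (i : ℕ) < k) (rowNorm (Qᵀ * X)) :=
    infOver_pos hex fun i hi =>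
      pos_of_mul_pos_left (dvec_pos_of_lt hm.le hG1 (hi.trans_le hkm)) (hV0 i)
  have hYinf : 1 ≤ infOver (fun i => (i : ℕ) < k)
      (rowNorm (Qᵀ * ymat m hm.le lam p Q X Gpinv)) :=
    le_infOver hex fun i hi => (rowNorm_ymat_of_lt hm.le hG1 hQ' hkm hi).ge
  have hWsup : |ρ (lam ⟨k, by omega⟩)| ^ q * infOver (fun j => k ≤ (j : ℕ)) (rowNorm (Qᵀ * X₀)) ≤
      supOver (fun i => k ≤ (i : ℕ)) (rowNorm (Qᵀ * X)) := by
    refine le_trans ?_ (le_supOver (i := ⟨k, by omega⟩) le_rfl)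
    rw [hW]
    gcongr
    exact infOver_le le_rfl
  have hρk : 0 < |ρ (lam ⟨k, by omega⟩)| ^ q := pow_pos (abs_pos.2 hρk1) q
  have hN := specNorm_nonneg (Gpinv * ekMat m k)
  have hS₀ : 0 ≤ supOver (fun j => m ≤ (j : ℕ)) (rowNorm (Qᵀ * X₀)) :=
    (rowNorm_nonneg _ _).trans (le_supOver (i := ⟨m, hm⟩) le_rfl)
  have hSV : 0 ≤ supOver (fun j => m ≤ (j : ℕ)) (rowNorm (vand lam p)) :=
    (rowNorm_nonneg _ _).trans (le_supOver (i := ⟨m, hm⟩) le_rfl)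
  have hlow (i : Fin n) (hi : m ≤ (i : ℕ)) :
      dvec lam p Q X i ≤ |ρ (lam ⟨m, hm⟩)| ^ q *
        supOver (fun j => m ≤ (j : ℕ)) (rowNorm (Qᵀ * X₀)) *
        supOver (fun j => m ≤ (j : ℕ)) (rowNorm (vand lam p)) := by
    rw [dvec, hW]
    have h₁ := hordmax i hi
    have h₂ : rowNorm (Qᵀ * X₀) i ≤ _ := le_supOver (P := fun j => m ≤ (j : ℕ)) hi
    have h₃ : rowNorm (vand lam p) i ≤ _ := le_supOver (P := fun j => m ≤ (j : ℕ)) hi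
    have := rowNorm_nonneg (Qᵀ * X₀) i
    gcongr
    exact hV0 i
  have htop (j : Fin n) (hj : (j : ℕ) < k) :
      infOver (fun i => (i : ℕ) < k) (rowNorm (Qᵀ * X)) *
        infOver (fun i => (i : ℕ) < k) (rowNorm (vand lam p)) ≤ dvec lam p Q X j :=
    mul_le_mul (infOver_le hj) (infOver_le hj) hV.le (rowNorm_nonneg _ _)
  have hYlow := rowNorm_ymat_le (Gpinv := Gpinv) hQ' hkm hm.le (mul_pos hWinf hV) htop
  simp only [deltaK, gammaKM, abs_div, div_pow]
  set S₀ := supOver (fun j => m ≤ (j : ℕ)) (rowNorm (Qᵀ * X₀))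
  set I₀ := infOver (fun j => k ≤ (j : ℕ)) (rowNorm (Qᵀ * X₀))
  set SV := supOver (fun j => m ≤ (j : ℕ)) (rowNorm (vand lam p))
  set IV := infOver (fun i => (i : ℕ) < k) (rowNorm (vand lam p))
  set SW := supOver (fun i => k ≤ (i : ℕ)) (rowNorm (Qᵀ * X))
  set IW := infOver (fun i => (i : ℕ) < k) (rowNorm (Qᵀ * X))
  set N := specNorm (Gpinv * ekMat m k)
  set a := |ρ (lam ⟨m, hm⟩)| ^ q
  set b := |ρ (lam ⟨k, by omega⟩)| ^ q
  have ha : 0 ≤ a := by positivity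
  have hSW : 0 ≤ SW := by
    have := mul_pos hρk hX₀'
    exact this.le.trans hWsup
  have hbound : supOver (fun i => k ≤ (i : ℕ)) (rowNorm (Qᵀ * ymat m hm.le lam p Q X Gpinv)) ≤
      a * S₀ * SV / (IW * IV) * N := by
    refine supOver_le ⟨⟨m, hm⟩, hkm⟩ fun i hi => ?_
    rcases lt_or_ge (i : ℕ) m with him | him
    · rw [rowNorm_ymat_of_le_of_lt hm.le hG1 hQ' hkm hi him]
      positivity
    · refine (hYlow i).trans ?_
      gcongr
      exact hlow i him
  have hnonneg : 0 ≤ a * S₀ * SV / (IW * IV) * N := by positivity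
  calc _ ≤ a * S₀ * SV / (IW * IV) * N / 1 :=
        div_le_div₀ hnonneg hbound one_pos hYinf
    _ ≤ a * S₀ * SV / (IW * IV) * N * (SW / (b * I₀)) := by
        rw [div_one]
        exact le_mul_of_one_le_right hnonneg ((one_le_div (mul_pos hρk hX₀')).2 hWsup)
    _ = S₀ / I₀ * (SV / IV) * N * (a / b) * (SW / IW) := by
        simp only [div_eq_mul_inv, mul_inv]
        ring
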